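/- arXiv:1311.2812 — 2 statements merged into one kernel-verified Lean document; each statement's English description precedes it below -/
import Mathlib

section
/- Let d ≥ 2, let Ω ⊂ ℝ^d be a bounded convex open set, and let v : ℝ^d → ℝ be of class C⁴. Then there exist C > 0 and h₀ ∈ (0,1) such that for every 0 < h ≤ h₀ and every x ∈ Ω_h⁰: |(1/d) div_h[(cof H_d(r_h v))ᵀ D_h(r_h v)](x) − det D²v(x)| ≤ C h, where the vector-valued grid function y ↦ (cof H_d(r_h v)(y))ᵀ (D_h r_h v)(y) is formed pointwise on ℤ_h. -/
noncomputable section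

namespace MA

variable {d : ℕ}

/-- the `i`-th standard basis vector of `ℝ^d`. -/
def bv (d : ℕ) (i : Fin d) : Fin d → ℝ := Pi.single i 1

def lamMin (A : Matrix (Fin d) (Fin d) ℝ) : ℝ := sInf (spectrum ℝ A)

def lamMax (A : Matrix (Fin d) (Fin d) ℝ) : ℝ := sSup (spectrum ℝ A)

def symPart (A : Matrix (Fin d) (Fin d) ℝ) : Matrix (Fin d) (Fin d) ℝ :=
  (1 / 2 : ℝ) • (A + A.transpose)

/-- the cofactor matrix: `Aᵀ * cof A = det A • 1`. -/
def cof (A : Matrix (Fin d) (Fin d) ℝ) : Matrix (Fin d) (Fin d) ℝ :=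
  (Matrix.adjugate A).transpose

/-- forward difference quotient `∂₊^i`. -/
def dp (h : ℝ) (i : Fin d) (v : (Fin d → ℝ) → ℝ) (x : Fin d → ℝ) : ℝ :=
  (v (x + h • bv d i) - v x) / h

/-- backward difference quotient `∂₋^i`. -/
def dm (h : ℝ) (i : Fin d) (v : (Fin d → ℝ) → ℝ) (x : Fin d → ℝ) : ℝ :=
  (v x - v (x - h • bv d i)) / h

/-- the discrete Hessian `H_d(v)(x)` with entries `∂₋^j ∂₊^i v(x)`. -/
def Hd (h : ℝ) (v : (Fin d → ℝ) → ℝ) (x : Fin d → ℝ) : Matrix (Fin d) (Fin d) ℝ :=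
  Matrix.of fun i j => dm h j (fun y => dp h i v y) x

/-- the discrete Hessian `Ĥ_d(v)(x)` with entries `∂₋^j ∂₋^i v(x)`. -/
def Hhat (h : ℝ) (v : (Fin d → ℝ) → ℝ) (x : Fin d → ℝ) : Matrix (Fin d) (Fin d) ℝ :=
  Matrix.of fun i j => dm h j (fun y => dm h i v y) x

/-- the central discrete Hessian `H̄_d(v)(x)`. -/
def Hc (h : ℝ) (v : (Fin d → ℝ) → ℝ) (x : Fin d → ℝ) : Matrix (Fin d) (Fin d) ℝ :=
  Matrix.of fun i j =>
    if i = j then (v (x + h • bv d i) - 2 * v x + v (x - h • bv d i)) / h ^ 2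
    else (v (x + h • bv d i + h • bv d j) - v (x + h • bv d i - h • bv d j)
          - v (x - h • bv d i + h • bv d j) + v (x - h • bv d i - h • bv d j)) / (4 * h ^ 2)

/-- the discrete gradient `D_h v = (∂₊^1 v, …, ∂₊^d v)`. -/
def Dh (h : ℝ) (v : (Fin d → ℝ) → ℝ) (x : Fin d → ℝ) : Fin d → ℝ := fun i => dp h i v x

/-- the discrete divergence `div_h w = Σ_i ∂₋^i w_i`. -/
def divh (h : ℝ) (w : (Fin d → ℝ) → Fin d → ℝ) (x : Fin d → ℝ) : ℝ :=
  ∑ i, dm h i (fun y => w y i) x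

/-- the discrete Laplacian `Δ_h v = Σ_i ∂₊^i ∂₋^i v`. -/
def lapH (h : ℝ) (v : (Fin d → ℝ) → ℝ) (x : Fin d → ℝ) : ℝ :=
  ∑ i, dp h i (fun y => dm h i v y) x

/-- the grid `ℤ_h = {x : x_i / h ∈ ℤ}`. -/
def gridZ (d : ℕ) (h : ℝ) : Set (Fin d → ℝ) := {x | ∀ i, ∃ k : ℤ, x i = (k : ℝ) * h}

/-- `Ω_h = cl(Ω) ∩ ℤ_h`. -/
def OmegaH (Ω : Set (Fin d → ℝ)) (h : ℝ) : Set (Fin d → ℝ) := closure Ω ∩ gridZ d h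

/-- `Ω_h⁰ = {x ∈ Ω_h : x ± h e_i ± h e_j ∈ cl(Ω) for all i,j}`. -/
def OmegaH0 (Ω : Set (Fin d → ℝ)) (h : ℝ) : Set (Fin d → ℝ) :=
  {x | x ∈ OmegaH Ω h ∧ ∀ i j : Fin d, ∀ s t : Bool,
    x + (if s then h else -h) • bv d i + (if t then h else -h) • bv d j ∈ closure Ω}

/-- the discrete seminorm `|v|_{1,h}`. -/
def snorm1h (Ω : Set (Fin d → ℝ)) (h : ℝ) (v : (Fin d → ℝ) → ℝ) : ℝ :=
  Real.sqrt (∑ i : Fin d, h ^ d * ∑ᶠ x ∈ OmegaH0 Ω h, (dp h i v x) ^ 2)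

/-- the Hessian matrix `D²v(x)` of second partial derivatives. -/
def hess (v : (Fin d → ℝ) → ℝ) (x : Fin d → ℝ) : Matrix (Fin d) (Fin d) ℝ :=
  Matrix.of fun i j => iteratedFDeriv ℝ 2 v x ![bv d i, bv d j]

/-- the compatible discrete Monge–Ampère operator
`(1/d) div_h [(cof sym H_d v) D_h v]`. -/
def MAh (h : ℝ) (v : (Fin d → ℝ) → ℝ) (x : Fin d → ℝ) : ℝ :=
  (1 / (d : ℝ)) * divh h (fun y => (cof (symPart (Hd h v y))).mulVec (Dh h v y)) x

end MA

namespace MA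

/-- the `i`-th partial derivative of `u`. -/
def pd (i : Fin d) (u : (Fin d → ℝ) → ℝ) (x : Fin d → ℝ) : ℝ := fderiv ℝ u x (bv d i)

lemma contDiff_pd {m n : WithTop ℕ∞} (hmn : m + 1 ≤ n) {u : (Fin d → ℝ) → ℝ}
    (hu : ContDiff ℝ n u) (i : Fin d) : ContDiff ℝ m (pd i u) :=
  (hu.fderiv_right hmn).clm_apply contDiff_const

lemma fderiv_fderiv_apply_bv {u : (Fin d → ℝ) → ℝ} (hu : ContDiff ℝ 2 u) (i j : Fin d)
    (x : Fin d → ℝ) : fderiv ℝ (fderiv ℝ u) x (bv d i) (bv d j) = pd i (pd j u) x := by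
  have h1 : DifferentiableAt ℝ (fderiv ℝ u) x :=
    (hu.fderiv_right (m := 1) (by norm_num)).differentiable one_ne_zero x
  have h2 := (h1.hasFDerivAt.clm_apply (hasFDerivAt_const (bv d j) x)).fderiv
  unfold pd
  rw [h2]
  simp

lemma pd_comm {u : (Fin d → ℝ) → ℝ} (hu : ContDiff ℝ 2 u) (i j : Fin d) :
    pd i (pd j u) = pd j (pd i u) := by
  ext x
  have h : IsSymmSndFDerivAt ℝ u x := hu.contDiffAt.isSymmSndFDerivAt (by simp)
  rw [← fderiv_fderiv_apply_bv hu, ← fderiv_fderiv_apply_bv hu, h.eq]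

lemma hess_apply {u : (Fin d → ℝ) → ℝ} (hu : ContDiff ℝ 2 u) (x : Fin d → ℝ) (i j : Fin d) :
    hess u x i j = pd i (pd j u) x := by
  rw [← fderiv_fderiv_apply_bv hu]
  simp [hess, iteratedFDeriv_two_apply]

lemma contDiff_dp {n : WithTop ℕ∞} {u : (Fin d → ℝ) → ℝ} (hu : ContDiff ℝ n u) (h : ℝ)
    (i : Fin d) : ContDiff ℝ n (dp h i u) :=
  ((hu.comp (contDiff_id.add contDiff_const)).sub hu).div_const h

lemma contDiff_dm {n : WithTop ℕ∞} {u : (Fin d → ℝ) → ℝ} (hu : ContDiff ℝ n u) (h : ℝ)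
    (i : Fin d) : ContDiff ℝ n (dm h i u) :=
  (hu.sub (hu.comp (contDiff_id.sub contDiff_const))).div_const h

lemma pd_dp {u : (Fin d → ℝ) → ℝ} (hu : Differentiable ℝ u) (h : ℝ) (i j : Fin d) :
    pd i (dp h j u) = dp h j (pd i u) := by
  ext x
  have h1 : HasFDerivAt (dp h j u)
      (h⁻¹ • (fderiv ℝ u (x + h • bv d j) - fderiv ℝ u x)) x := by
    have h2 : HasFDerivAt (fun y => u (y + h • bv d j)) (fderiv ℝ u (x + h • bv d j)) x :=
      (hasFDerivAt_comp_add_right (h • bv d j)).2 (hu _).hasFDerivAt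
    have h3 := (h2.sub (hu x).hasFDerivAt).const_smul h⁻¹
    refine h3.congr_of_eventuallyEq (Filter.Eventually.of_forall fun y => ?_)
    simp [dp, div_eq_inv_mul]
  rw [pd, h1.fderiv]
  simp [dp, pd, div_eq_inv_mul]

lemma dm_eq_dp (h : ℝ) (i : Fin d) (u : (Fin d → ℝ) → ℝ) : dm h i u = dp (-h) i u := by
  ext x
  simp only [dm, dp, neg_smul, ← sub_eq_add_neg, div_neg, ← neg_div, neg_sub]

lemma pd_dm {u : (Fin d → ℝ) → ℝ} (hu : Differentiable ℝ u) (h : ℝ) (i j : Fin d) :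
    pd i (dm h j u) = dm h j (pd i u) := by
  rw [dm_eq_dp, dm_eq_dp, pd_dp hu]

lemma exists_dp_eq_pd_add {u : (Fin d → ℝ) → ℝ} (hu : Differentiable ℝ u) {h : ℝ} (hh : 0 < h)
    (i : Fin d) (x : Fin d → ℝ) :
    ∃ t ∈ Set.Ioo 0 h, dp h i u x = pd i u (x + t • bv d i) := by
  have hd : ∀ t : ℝ, HasDerivAt (fun t : ℝ => u (x + t • bv d i))
      (fderiv ℝ u (x + t • bv d i) (bv d i)) t := fun t => by
    have h1 : HasDerivAt (fun t : ℝ => x + t • bv d i) (bv d i) t := by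
      simpa using ((hasDerivAt_id t).smul_const (bv d i)).const_add x
    exact (hu _).hasFDerivAt.comp_hasDerivAt t h1
  obtain ⟨t, ht, hte⟩ := exists_hasDerivAt_eq_slope _ _ hh
    (fun t _ => (hd t).continuousAt.continuousWithinAt) (fun t _ => hd t)
  refine ⟨t, ht, ?_⟩
  rw [pd, hte]
  simp [dp]

lemma norm_smul_bv (t : ℝ) (i : Fin d) : ‖t • bv d i‖ = |t| := by
  simp [bv, norm_smul, Pi.norm_single]

/-- mean value theorem for forward difference quotients. -/
lemma exists_dp_eq_pd {u : (Fin d → ℝ) → ℝ} (hu : Differentiable ℝ u) {h : ℝ} (hh : 0 < h)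
    (i : Fin d) (x : Fin d → ℝ) : ∃ y, ‖y - x‖ ≤ h ∧ dp h i u x = pd i u y := by
  obtain ⟨t, ht, hte⟩ := exists_dp_eq_pd_add hu hh i x
  refine ⟨_, ?_, hte⟩
  rw [add_sub_cancel_left, norm_smul_bv, abs_of_pos ht.1]
  exact ht.2.le

/-- mean value theorem for backward difference quotients. -/
lemma exists_dm_eq_pd {u : (Fin d → ℝ) → ℝ} (hu : Differentiable ℝ u) {h : ℝ} (hh : 0 < h)
    (i : Fin d) (x : Fin d → ℝ) : ∃ y, ‖y - x‖ ≤ h ∧ dm h i u x = pd i u y := by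
  obtain ⟨t, ht, hte⟩ := exists_dp_eq_pd_add hu hh i (x - h • bv d i)
  refine ⟨_, ?_, Eq.trans ?_ hte⟩
  · have : x - h • bv d i + t • bv d i - x = (t - h) • bv d i := by module
    rw [this, norm_smul_bv, abs_le]
    constructor <;> linarith [ht.1, ht.2]
  · simp [dm, dp]

/-- the determinant as a continuous alternating map of the rows. -/
def detRow (d : ℕ) : (Fin d → ℝ) [⋀^Fin d]→L[ℝ] ℝ where
  toMultilinearMap := (Matrix.detRowAlternating (n := Fin d) (R := ℝ)).toMultilinearMap
  cont := Continuous.matrix_det (continuous_id : Continuous fun A : Matrix (Fin d) (Fin d) ℝ => A)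
  map_eq_zero_of_eq' := (Matrix.detRowAlternating (n := Fin d) (R := ℝ)).map_eq_zero_of_eq'

lemma adjugate_apply_eq_detRow (A : Fin d → Fin d → ℝ) (i j : Fin d) :
    (Matrix.of A).adjugate i j = detRow d (Function.update A j (bv d i)) := by
  rw [Matrix.adjugate_apply]
  rfl

/-- the `i`-th component of `(cof A)ᵀ g`. -/
def flux (i : Fin d) (p : (Fin d → Fin d → ℝ) × (Fin d → ℝ)) : ℝ :=
  ∑ j, detRow d (Function.update p.1 j (bv d i)) * p.2 j

lemma cof_transpose_mulVec (A : Fin d → Fin d → ℝ) (g : Fin d → ℝ) (i : Fin d) :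
    ((cof (Matrix.of A)).transpose).mulVec g i = flux i (A, g) := by
  simp [cof, Matrix.mulVec, dotProduct, flux, adjugate_apply_eq_detRow]

lemma hasFDerivAt_update_row (A : Fin d → Fin d → ℝ) (j : Fin d) (c : Fin d → ℝ) :
    HasFDerivAt (fun A : Fin d → Fin d → ℝ => Function.update A j c)
      (ContinuousLinearMap.pi fun k =>
        if k = j then 0 else ContinuousLinearMap.proj (R := ℝ) (φ := fun _ : Fin d => Fin d → ℝ) k)
      A := by
  rw [hasFDerivAt_pi]
  intro k
  by_cases hk : k = j
  · subst hk
    simp only [Function.update_self, if_true]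
    exact hasFDerivAt_const c A
  · simp only [ne_eq, hk, not_false_eq_true, Function.update_of_ne, if_false]
    exact hasFDerivAt_apply k A

lemma contDiff_flux {n : WithTop ℕ∞} (i : Fin d) : ContDiff ℝ n (flux i) := by
  have h1 : ∀ j, ContDiff ℝ n fun A : Fin d → Fin d → ℝ => Function.update A j (bv d i) := by
    intro j
    rw [contDiff_pi]
    intro k
    by_cases hk : k = j
    · subst hk
      simpa using contDiff_const
    · simpa [hk] using contDiff_apply ℝ (Fin d → ℝ) k
  refine ContDiff.sum fun j _ => ?_
  exact ((detRow d).contDiff.comp ((h1 j).comp contDiff_fst)).mul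
    ((contDiff_apply ℝ ℝ j).comp contDiff_snd)

lemma fderiv_flux_apply (i : Fin d) (A T : Fin d → Fin d → ℝ) (g B : Fin d → ℝ) :
    fderiv ℝ (flux i) (A, g) (T, B) =
      ∑ j, ((∑ k, if k = j then 0 else
          detRow d (Function.update (Function.update A j (bv d i)) k (T k))) * g j
        + detRow d (Function.update A j (bv d i)) * B j) := by
  have h1 : ∀ j, HasFDerivAt (fun p : (Fin d → Fin d → ℝ) × (Fin d → ℝ) =>
      detRow d (Function.update p.1 j (bv d i))) _ (A, g) := fun j =>
    (((detRow d).hasFDerivAt (Function.update A j (bv d i))).comp A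
      (hasFDerivAt_update_row A j (bv d i))).comp (f := Prod.fst) (A, g) hasFDerivAt_fst
  have h2 : ∀ j, HasFDerivAt (fun p : (Fin d → Fin d → ℝ) × (Fin d → ℝ) => p.2 j) _ (A, g) :=
    fun j => (hasFDerivAt_apply (𝕜 := ℝ) j g).comp (f := Prod.snd) (A, g) hasFDerivAt_snd
  have h3 : HasFDerivAt (flux i) _ (A, g) :=
    HasFDerivAt.fun_sum fun j (_ : j ∈ Finset.univ) => (h1 j).mul (h2 j)
  rw [h3.fderiv]
  simp only [_root_.sum_apply, _root_.add_apply,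
    _root_.smul_apply, ContinuousLinearMap.comp_apply, smul_eq_mul,
    ContinuousMultilinearMap.linearDeriv_apply]
  refine Finset.sum_congr rfl fun j _ => ?_
  rw [add_comm, mul_comm _ (g j)]
  congr 2
  refine Finset.sum_congr rfl fun k _ => ?_
  by_cases hk : k = j
  · simp [hk]
  · simp [hk]

/-- algebraic form of the Piola identity. -/
lemma sum_detRow_update_eq_zero (A : Fin d → Fin d → ℝ) {j k : Fin d} (hkj : k ≠ j)
    (S : Fin d → Fin d → ℝ) (hS : ∀ i l, S i l = S l i) :
    ∑ i, detRow d (Function.update (Function.update A j (bv d i)) k (S i)) = 0 := by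
  set G : Fin d → Fin d → ℝ := fun i l =>
    detRow d (Function.update (Function.update A j (bv d i)) k (bv d l)) with hG
  have hanti : ∀ i l, G l i = - G i l := by
    intro i l
    have := (detRow d).toAlternatingMap.map_swap
      (Function.update (Function.update A j (bv d i)) k (bv d l)) hkj
    simp only [hG]
    refine Eq.trans ?_ this
    refine congrArg (detRow d) (funext fun m => ?_)
    by_cases h1 : m = k
    · subst h1; simp [hkj.symm]
    by_cases h2 : m = j
    · subst h2; simp [h1]
    simp [h1, h2, Equiv.swap_apply_of_ne_of_ne]
  have hexp : ∀ i, detRow d (Function.update (Function.update A j (bv d i)) k (S i))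
      = ∑ l, S i l * G i l := by
    intro i
    have : S i = ∑ l, S i l • bv d l := by
      ext m; simp [bv, Finset.sum_apply, Pi.single_apply]
    conv_lhs => rw [this]
    have := (detRow d).toMultilinearMap.map_update_sum Finset.univ k (fun l => S i l • bv d l)
      (Function.update A j (bv d i))
    refine this.trans (Finset.sum_congr rfl fun l _ => ?_)
    exact ((detRow d).toMultilinearMap.map_update_smul _ k (S i l) (bv d l))
  simp only [hexp]
  have hneg : ∑ i, ∑ l, S i l * G i l = - ∑ i, ∑ l, S i l * G i l := by
    conv_lhs => rw [Finset.sum_comm]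
    simp only [← Finset.sum_neg_distrib]
    refine Finset.sum_congr rfl fun i _ => Finset.sum_congr rfl fun l _ => ?_
    rw [hanti i l, hS l i]; ring
  linarith

lemma sum_fderiv_flux (A : Fin d → Fin d → ℝ) (g : Fin d → ℝ) (T : Fin d → Fin d → Fin d → ℝ)
    (hT : ∀ i k l, T i k l = T l k i) :
    ∑ i, fderiv ℝ (flux i) (A, g) (T i, fun j => A j i) = d * (Matrix.of A).det := by
  simp only [fderiv_flux_apply, Finset.sum_add_distrib]
  have h1 : ∑ i, ∑ j, (∑ k, if k = j then 0 else
      detRow d (Function.update (Function.update A j (bv d i)) k (T i k))) * g j = 0 := by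
    rw [Finset.sum_comm]
    refine Finset.sum_eq_zero fun j _ => ?_
    rw [← Finset.sum_mul, Finset.sum_comm]
    refine mul_eq_zero_of_left (Finset.sum_eq_zero fun k _ => ?_) _
    by_cases hk : k = j
    · simp [hk]
    · simpa [hk] using sum_detRow_update_eq_zero A hk (fun i => T i k) (fun i l => hT i k l)
  have h2 : ∑ i, ∑ j, detRow d (Function.update A j (bv d i)) * A j i
      = ((Matrix.of A).adjugate * Matrix.of A).trace := by
    simp [Matrix.trace, Matrix.mul_apply, adjugate_apply_eq_detRow]
  rw [h1, h2, Matrix.adjugate_mul, Matrix.trace_smul, Matrix.trace_one]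
  simp [mul_comm]

/-- Hessian (with the index order of `Hd`) and gradient of `v`. -/
def jet (v : (Fin d → ℝ) → ℝ) (x : Fin d → ℝ) : (Fin d → Fin d → ℝ) × (Fin d → ℝ) :=
  (fun k l => pd l (pd k v) x, fun j => pd j v x)

/-- discrete Hessian and discrete gradient of `v`. -/
def jetH (h : ℝ) (v : (Fin d → ℝ) → ℝ) (x : Fin d → ℝ) : (Fin d → Fin d → ℝ) × (Fin d → ℝ) :=
  (fun k l => dm h l (dp h k v) x, fun j => dp h j v x)

lemma differentiableAt_and_fderiv_pair_apply {a : Fin d → Fin d → (Fin d → ℝ) → ℝ} {b : Fin d → (Fin d → ℝ) → ℝ}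
    (ha : ∀ k l, Differentiable ℝ (a k l)) (hb : ∀ j, Differentiable ℝ (b j)) (i : Fin d)
    (x : Fin d → ℝ) :
    DifferentiableAt ℝ (fun y => ((fun k l => a k l y, fun j => b j y) :
      (Fin d → Fin d → ℝ) × (Fin d → ℝ))) x ∧
    fderiv ℝ (fun y => ((fun k l => a k l y, fun j => b j y) :
      (Fin d → Fin d → ℝ) × (Fin d → ℝ))) x (bv d i)
      = (fun k l => pd i (a k l) x, fun j => pd i (b j) x) := by
  have h1 : HasFDerivAt (fun y => (fun k l => a k l y : Fin d → Fin d → ℝ))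
      (ContinuousLinearMap.pi fun k => ContinuousLinearMap.pi fun l => fderiv ℝ (a k l) x) x :=
    hasFDerivAt_pi.2 fun k => hasFDerivAt_pi.2 fun l => (ha k l x).hasFDerivAt
  have h2 : HasFDerivAt (fun y => (fun j => b j y : Fin d → ℝ))
      (ContinuousLinearMap.pi fun j => fderiv ℝ (b j) x) x :=
    hasFDerivAt_pi.2 fun j => (hb j x).hasFDerivAt
  refine ⟨(h1.prodMk h2).differentiableAt, ?_⟩
  rw [(h1.prodMk h2).fderiv]
  rfl

lemma contDiff_jet {v : (Fin d → ℝ) → ℝ} (hv : ContDiff ℝ 4 v) : ContDiff ℝ 2 (jet v) := by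
  refine ContDiff.prodMk (contDiff_pi.2 fun k => contDiff_pi.2 fun l => ?_)
    (contDiff_pi.2 fun j => ?_)
  · exact contDiff_pd (n := 3) (by norm_num) (contDiff_pd (n := 4) (by norm_num) hv k) l
  · exact contDiff_pd (n := 4) (by norm_num) hv j

lemma fderiv_jet_apply {v : (Fin d → ℝ) → ℝ} (hv : ContDiff ℝ 4 v) (i : Fin d) (x : Fin d → ℝ) :
    fderiv ℝ (jet v) x (bv d i)
      = (fun k l => pd i (pd l (pd k v)) x, fun j => pd i (pd j v) x) := by
  refine (differentiableAt_and_fderiv_pair_apply (fun k l => ?_) (fun j => ?_) i x).2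
  · exact (contDiff_pd (m := 2) (n := 3) (by norm_num)
      (contDiff_pd (n := 4) (by norm_num) hv k) l).differentiable two_ne_zero
  · exact (contDiff_pd (m := 3) (n := 4) (by norm_num) hv j).differentiable three_ne_zero

lemma differentiableAt_and_fderiv_jetH_apply {v : (Fin d → ℝ) → ℝ} (hv : ContDiff ℝ 1 v) (h : ℝ) (i : Fin d)
    (x : Fin d → ℝ) : DifferentiableAt ℝ (jetH h v) x ∧
      fderiv ℝ (jetH h v) x (bv d i) = jetH h (pd i v) x := by
  have hd := hv.differentiable one_ne_zero
  have hdp : ∀ k, Differentiable ℝ (dp h k v) := fun k =>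
    (contDiff_dp hv h k).differentiable one_ne_zero
  have hdm : ∀ k l, Differentiable ℝ (dm h l (dp h k v)) := fun k l =>
    (contDiff_dm (contDiff_dp hv h k) h l).differentiable one_ne_zero
  refine (differentiableAt_and_fderiv_pair_apply hdm hdp i x).imp_right fun hf => hf.trans ?_
  simp only [jetH, pd_dp hd, pd_dm (hdp _)]

/-- the Hessian, the gradient and their `i`-th partial derivatives. -/
def jetD (i : Fin d) (v : (Fin d → ℝ) → ℝ) (x : Fin d → ℝ) :
    ((Fin d → Fin d → ℝ) × (Fin d → ℝ)) × ((Fin d → Fin d → ℝ) × (Fin d → ℝ)) :=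
  (jet v x, fderiv ℝ (jet v) x (bv d i))

lemma contDiff_jetD {v : (Fin d → ℝ) → ℝ} (hv : ContDiff ℝ 4 v) (i : Fin d) :
    ContDiff ℝ 1 (jetD i v) :=
  ((contDiff_jet hv).of_le (by norm_num)).prodMk
    (((contDiff_jet hv).fderiv_right (m := 1) (by norm_num)).clm_apply contDiff_const)

lemma exists_jetH_entry {u : (Fin d → ℝ) → ℝ} (hu : ContDiff ℝ 2 u) {h : ℝ} (hh : 0 < h)
    (k l : Fin d) (z : Fin d → ℝ) :
    ∃ y, ‖y - z‖ ≤ 2 * h ∧ (jetH h u z).1 k l = pd l (pd k u) y := by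
  have hd : Differentiable ℝ u := hu.differentiable two_ne_zero
  have h1 : Differentiable ℝ (dp h k u) := (contDiff_dp hu h k).differentiable two_ne_zero
  have h2 : Differentiable ℝ (pd l u) :=
    (contDiff_pd (m := 1) (by norm_num) hu l).differentiable one_ne_zero
  obtain ⟨y, hy, hye⟩ := exists_dm_eq_pd h1 hh l z
  rw [pd_dp hd] at hye
  obtain ⟨y', hy', hye'⟩ := exists_dp_eq_pd h2 hh k y
  refine ⟨y', ?_, ?_⟩
  · calc ‖y' - z‖ = ‖(y' - y) + (y - z)‖ := by rw [sub_add_sub_cancel]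
      _ ≤ ‖y' - y‖ + ‖y - z‖ := norm_add_le _ _
      _ ≤ 2 * h := by linarith
  · rw [pd_comm hu l k, ← hye', ← hye]
    rfl

lemma norm_jetH_sub_jetD_le {v : (Fin d → ℝ) → ℝ} (hv : ContDiff ℝ 4 v) (i : Fin d) {h ε : ℝ}
    (hh : 0 < h) (hε : 0 ≤ ε) {x z : Fin d → ℝ} (hz : ‖z - x‖ ≤ h)
    (hJ : ∀ y, ‖y - x‖ ≤ 3 * h → ‖jetD i v y - jetD i v x‖ ≤ ε) :
    ‖((jetH h v z, jetH h (pd i v) z) :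
      ((Fin d → Fin d → ℝ) × (Fin d → ℝ)) × ((Fin d → Fin d → ℝ) × (Fin d → ℝ)))
        - jetD i v x‖ ≤ ε := by
  have hv2 : ContDiff ℝ 2 v := hv.of_le (by norm_num)
  have hp3 : ∀ j, ContDiff ℝ 3 (pd j v) := contDiff_pd (by norm_num) hv
  have hp2 : ∀ j, ContDiff ℝ 2 (pd j v) := fun j => (hp3 j).of_le (by norm_num)
  have hdist : ∀ y, ‖y - z‖ ≤ 2 * h → ‖y - x‖ ≤ 3 * h := fun y hy => by
    calc ‖y - x‖ = ‖(y - z) + (z - x)‖ := by rw [sub_add_sub_cancel]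
      _ ≤ ‖y - z‖ + ‖z - x‖ := norm_add_le _ _
      _ ≤ 3 * h := by linarith
  have hJ' : ∀ y, ‖y - z‖ ≤ 2 * h →
      ((∀ k l, |(jet v y).1 k l - (jet v x).1 k l| ≤ ε) ∧
        ∀ j, |(jet v y).2 j - (jet v x).2 j| ≤ ε) ∧
      (∀ k l, |pd i (pd l (pd k v)) y - pd i (pd l (pd k v)) x| ≤ ε) ∧
        ∀ j, |pd i (pd j v) y - pd i (pd j v) x| ≤ ε := fun y hy => by
    have := hJ y (hdist y hy)
    simpa only [jetD, fderiv_jet_apply hv, Prod.mk_sub_mk, Prod.norm_mk, max_le_iff,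
      norm_prod_le_iff, pi_norm_le_iff_of_nonneg hε, Prod.fst_sub, Prod.snd_sub, Pi.sub_apply,
      Real.norm_eq_abs] using this
  simp only [jetD, fderiv_jet_apply hv, Prod.mk_sub_mk, Prod.norm_mk, max_le_iff,
      norm_prod_le_iff, pi_norm_le_iff_of_nonneg hε, Prod.fst_sub, Prod.snd_sub, Pi.sub_apply,
      Real.norm_eq_abs]
  refine ⟨⟨fun k l => ?_, fun j => ?_⟩, fun k l => ?_, fun j => ?_⟩
  · obtain ⟨y, hy, hye⟩ := exists_jetH_entry hv2 hh k l z
    rw [hye]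
    exact (hJ' y hy).1.1 k l
  · obtain ⟨y, hy, hye⟩ := exists_dp_eq_pd (hv2.differentiable two_ne_zero) hh j z
    have := (hJ' y (by linarith)).1.2 j
    simp only [jetH, hye]
    exact this
  · obtain ⟨y, hy, hye⟩ := exists_jetH_entry (hp2 i) hh k l z
    have := (hJ' y hy).2.1 k l
    rwa [hye, ← pd_comm hv2 i k, ← pd_comm (hp2 k) i l]
  · obtain ⟨y, hy, hye⟩ := exists_dp_eq_pd ((hp2 i).differentiable two_ne_zero) hh j z
    have := (hJ' y (by linarith)).2.2 j
    simp only [jetH, hye]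
    rwa [← pd_comm hv2 i j]

lemma exists_abs_dm_flux_sub_le {v : (Fin d → ℝ) → ℝ} (hv : ContDiff ℝ 4 v) (i : Fin d) (R : ℝ) :
    ∃ C : ℝ, 0 ≤ C ∧ ∀ h : ℝ, 0 < h → h ≤ 1 / 2 → ∀ x : Fin d → ℝ, ‖x‖ ≤ R →
      |dm h i (fun y => flux i (jetH h v y)) x
        - fderiv ℝ (flux i) (jet v x) (fderiv ℝ (jet v) x (bv d i))| ≤ C * h := by
  have hv1 : ContDiff ℝ 1 v := hv.of_le (by norm_num)
  obtain ⟨L, hL⟩ := (contDiff_jetD hv i).contDiffOn.exists_lipschitzOnWith one_ne_zero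
    (convex_closedBall (0 : Fin d → ℝ) (R + 3)) (isCompact_closedBall _ _)
  obtain ⟨M, hM⟩ := ((isCompact_closedBall (0 : Fin d → ℝ) (R + 3)).image
    (contDiff_jetD hv i).continuous).isBounded.exists_norm_le
  have hΦ : ContDiff ℝ 1 fun p : ((Fin d → Fin d → ℝ) × (Fin d → ℝ)) ×
      ((Fin d → Fin d → ℝ) × (Fin d → ℝ)) => fderiv ℝ (flux i) p.1 p.2 :=
    (((contDiff_flux (n := 2) i).fderiv_right (m := 1) (by norm_num)).comp contDiff_fst).clm_apply
      contDiff_snd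
  obtain ⟨L', hL'⟩ := hΦ.contDiffOn.exists_lipschitzOnWith one_ne_zero
    (convex_closedBall (0 : ((Fin d → Fin d → ℝ) × (Fin d → ℝ)) ×
      ((Fin d → Fin d → ℝ) × (Fin d → ℝ))) (M + L * 3)) (isCompact_closedBall _ _)
  rw [lipschitzOnWith_iff_norm_sub_le] at hL hL'
  refine ⟨L' * (L * 3), by positivity, fun h hh hh2 x hx => ?_⟩
  have hjd : ∀ z, DifferentiableAt ℝ (jetH h v) z := fun z => (differentiableAt_and_fderiv_jetH_apply hv1 h i z).1
  have hfl : Differentiable ℝ (flux i) := (contDiff_flux (n := 1) i).differentiable one_ne_zero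
  obtain ⟨z, hz, hze⟩ := exists_dm_eq_pd (u := fun y => flux i (jetH h v y))
    (fun z => (hfl _).comp z (hjd z)) hh i x
  have hpd : pd i (fun y => flux i (jetH h v y)) z
      = fderiv ℝ (flux i) (jetH h v z) (jetH h (pd i v) z) := by
    have := ((hfl (jetH h v z)).hasFDerivAt.comp z (hjd z).hasFDerivAt).fderiv
    rw [← (differentiableAt_and_fderiv_jetH_apply hv1 h i z).2]
    exact congrArg (fun F => F (bv d i)) this
  have hxK : x ∈ Metric.closedBall (0 : Fin d → ℝ) (R + 3) := by
    rw [mem_closedBall_zero_iff]; linarith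
  have hclose := norm_jetH_sub_jetD_le hv i (ε := L * 3 * h) hh (by positivity) hz (fun y hy => by
    have hyK : y ∈ Metric.closedBall (0 : Fin d → ℝ) (R + 3) := by
      rw [mem_closedBall_zero_iff]
      have := norm_le_norm_add_norm_sub' y x
      linarith
    calc _ ≤ L * ‖y - x‖ := hL hyK hxK
      _ ≤ L * (3 * h) := by gcongr
      _ = L * 3 * h := by ring)
  have hJM : ‖jetD i v x‖ ≤ M := hM _ ⟨x, hxK, rfl⟩
  have hL0 : 0 ≤ (L : ℝ) * 3 := by positivity
  have hLh : (L : ℝ) * 3 * h ≤ L * 3 := mul_le_of_le_one_right hL0 (by linarith)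
  rw [hze, hpd, ← Real.norm_eq_abs]
  refine (hL' (x := (jetH h v z, jetH h (pd i v) z)) ?_ (y := jetD i v x) ?_).trans ?_
  · rw [mem_closedBall_zero_iff]
    have := norm_le_norm_add_norm_sub' (jetH h v z, jetH h (pd i v) z) (jetD i v x)
    linarith
  · rw [mem_closedBall_zero_iff]
    linarith
  · rw [mul_assoc (L' : ℝ)]
    gcongr

end MA

/-- first order consistency of the discretization
`(1/d) div_h[(cof H_d(r_h v))ᵀ D_h(r_h v)]` with `det D²v`. -/
theorem stmt5 {d : ℕ} (hd : 2 ≤ d) (Ω : Set (Fin d → ℝ))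
    (hΩo : IsOpen Ω) (hΩc : Convex ℝ Ω) (hΩb : Bornology.IsBounded Ω)
    (v : (Fin d → ℝ) → ℝ) (hv : ContDiff ℝ 4 v) :
    ∃ C h0 : ℝ, 0 < C ∧ 0 < h0 ∧ h0 < 1 ∧
      ∀ h : ℝ, 0 < h → h ≤ h0 → ∀ x ∈ MA.OmegaH0 Ω h,
        |(1 / (d : ℝ)) *
            MA.divh h (fun y => ((MA.cof (MA.Hd h v y)).transpose).mulVec (MA.Dh h v y)) x
          - (MA.hess v x).det| ≤ C * h := by
  obtain ⟨R, hR⟩ := hΩb.closure.exists_norm_le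
  choose C hC0 hC using fun i => MA.exists_abs_dm_flux_sub_le hv i R
  have hv2 : ContDiff ℝ 2 v := hv.of_le (by norm_num)
  have hp2 : ∀ j, ContDiff ℝ 2 (MA.pd j v) := MA.contDiff_pd (n := 4) (by norm_num) hv
  have hd1 : (1 : ℝ) ≤ d := by exact_mod_cast (by omega : 1 ≤ d)
  have hd0 : (0 : ℝ) < d := by linarith
  refine ⟨∑ i, C i + 1, 1 / 2, add_pos_of_nonneg_of_pos (Finset.sum_nonneg fun i _ => hC0 i)
    one_pos, by norm_num, by norm_num, fun h hh hh2 x hx => ?_⟩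
  have hxR : ‖x‖ ≤ R := hR x hx.1.1
  have hdiv : MA.divh h (fun y => ((MA.cof (MA.Hd h v y)).transpose).mulVec (MA.Dh h v y)) x
      = ∑ i, MA.dm h i (fun y => MA.flux i (MA.jetH h v y)) x := by
    refine Finset.sum_congr rfl fun i _ => ?_
    congr 1
    ext y
    exact MA.cof_transpose_mulVec _ _ i
  have hdet : ∑ i, fderiv ℝ (MA.flux i) (MA.jet v x) (fderiv ℝ (MA.jet v) x (MA.bv d i))
      = d * (MA.hess v x).det := by
    have hH : MA.hess v x = Matrix.of (MA.jet v x).1 := by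
      ext k l
      rw [MA.hess_apply hv2, MA.pd_comm hv2]
      rfl
    rw [hH, ← MA.sum_fderiv_flux _ (MA.jet v x).2
      (fun i k l => MA.pd i (MA.pd l (MA.pd k v)) x) fun i k l => by rw [MA.pd_comm (hp2 k)]]
    refine Finset.sum_congr rfl fun i _ => ?_
    rw [MA.fderiv_jet_apply hv]
    rfl
  have hdet' : (MA.hess v x).det = 1 / (d : ℝ) *
      ∑ i, fderiv ℝ (MA.flux i) (MA.jet v x) (fderiv ℝ (MA.jet v) x (MA.bv d i)) := by
    rw [hdet]
    field_simp
  rw [hdiv, hdet', ← mul_sub, ← Finset.sum_sub_distrib, abs_mul, abs_of_pos (by positivity)]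
  calc 1 / (d : ℝ) * |∑ i, (MA.dm h i (fun y => MA.flux i (MA.jetH h v y)) x
          - fderiv ℝ (MA.flux i) (MA.jet v x) (fderiv ℝ (MA.jet v) x (MA.bv d i)))|
      ≤ 1 * ∑ i, C i * h := by
        gcongr
        · rw [div_le_one hd0]
          exact hd1
        · exact (Finset.abs_sum_le_sum_abs _ _).trans
            (Finset.sum_le_sum fun i _ => hC i h hh hh2 x hxR)
    _ ≤ (∑ i, C i + 1) * h := by
        rw [one_mul, ← Finset.sum_mul]
        nlinarith
end
end

section
/- Let d ≥ 2, let Ω ⊂ ℝ^d be a bounded convex open set, and let v : ℝ^d → ℝ be of class C⁴. Then there exist C > 0 and h₀ ∈ (0,1) such that for every 0 < h ≤ h₀ and every x ∈ Ω_h⁰: |(1/d) div_h[(cof sym H_d(r_h v)) D_h(r_h v)](x) − det D²v(x)| ≤ C h, where the vector-valued grid function y ↦ (cof sym H_d(r_h v)(y)) (D_h r_h v)(y) is formed pointwise on ℤ_h. -/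
noncomputable section

section ParametricIntegral

variable {E F : Type} [NormedAddCommGroup E] [NormedSpace ℝ E] [FiniteDimensional ℝ E]

theorem hasFDerivAt_intervalIntegral_of_contDiff [NormedAddCommGroup F] [NormedSpace ℝ F]
    {G : E × ℝ → F} (hG : ContDiff ℝ 1 G) (a b : ℝ) (x₀ : E) :
    HasFDerivAt (fun x => ∫ t in a..b, G (x, t))
      (∫ t in a..b, (fderiv ℝ G (x₀, t)).comp (ContinuousLinearMap.inl ℝ E ℝ)) x₀ := by
  have hG' : Continuous fun p => (fderiv ℝ G p).comp (ContinuousLinearMap.inl ℝ E ℝ) :=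
    (hG.continuous_fderiv one_ne_zero).clm_comp continuous_const
  have hcont : ∀ x, Continuous fun t : ℝ => G (x, t) := fun x => hG.continuous.comp (by fun_prop)
  obtain ⟨B, hB⟩ := ((isCompact_closedBall x₀ 1).prod
    (isCompact_uIcc (a := a) (b := b))).exists_bound_of_continuousOn hG'.continuousOn
  refine intervalIntegral.hasFDerivAt_integral_of_dominated_of_fderiv_le
    (F := fun x t => G (x, t))
    (F' := fun x t => (fderiv ℝ G (x, t)).comp (ContinuousLinearMap.inl ℝ E ℝ))
    (bound := fun _ => B) (Metric.ball_mem_nhds x₀ one_pos)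
    (.of_forall fun x => (hcont x).aestronglyMeasurable)
    ((hcont x₀).intervalIntegrable _ _)
    (hG'.comp (by fun_prop : Continuous fun t : ℝ => (x₀, t))).aestronglyMeasurable
    (.of_forall fun t ht x hx =>
      hB (x, t) ⟨Metric.ball_subset_closedBall hx, Set.uIoc_subset_uIcc ht⟩)
    intervalIntegrable_const (.of_forall fun t _ x _ => ?_)
  exact ((hG.differentiable one_ne_zero) (x, t)).hasFDerivAt.comp x (hasFDerivAt_prodMk_left x t)

theorem contDiff_intervalIntegral (n : ℕ) :
    ∀ {F : Type} [NormedAddCommGroup F] [NormedSpace ℝ F] {G : E × ℝ → F} (_ : ContDiff ℝ n G)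
      (a b : ℝ), ContDiff ℝ n fun x => ∫ t in a..b, G (x, t) := by
  induction n with
  | zero =>
    intro F _ _ G hG a b
    simp only [Nat.cast_zero, contDiff_zero] at hG ⊢
    exact intervalIntegral.continuous_parametric_intervalIntegral_of_continuous'
      (f := fun x t => G (x, t)) hG a b
  | succ n ih =>
    intro F _ _ G hG a b
    have hd := hasFDerivAt_intervalIntegral_of_contDiff (hG.of_le (by simp)) a b
    push_cast at hG ⊢
    refine contDiff_succ_iff_fderiv.2 ⟨fun x => (hd x).differentiableAt, by simp, ?_⟩
    rw [funext fun x => (hd x).fderiv]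
    exact ih (G := fun p => (fderiv ℝ G p).comp (ContinuousLinearMap.inl ℝ E ℝ))
      ((hG.fderiv_right le_rfl).clm_comp contDiff_const) a b

/-- The forward difference quotient with step `h` extends to `h = 0` as a function that is jointly
smooth in `(h, x)`, with the loss of one derivative. -/
theorem exists_contDiff_forward_quotient {n : ℕ} {f : ℝ × E → ℝ} (hf : ContDiff ℝ (n + 1) f)
    (e : E) :
    ∃ g : ℝ × E → ℝ, ContDiff ℝ n g ∧
      (∀ h, h ≠ 0 → ∀ x, g (h, x) = (f (h, x + h • e) - f (h, x)) / h) ∧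
      ∀ x, g (0, x) = fderiv ℝ (fun y => f (0, y)) x e := by
  have hdiff : Differentiable ℝ f := hf.differentiable (by simp)
  let G : (ℝ × E) × ℝ → ℝ := fun q => fderiv ℝ f (q.1.1, q.1.2 + (q.2 * q.1.1) • e) (0, e)
  have hG : ContDiff ℝ n G :=
    ((hf.fderiv_right le_rfl).comp (by fun_prop)).clm_apply contDiff_const
  refine ⟨fun p => ∫ t in (0 : ℝ)..1, G (p, t), contDiff_intervalIntegral n hG 0 1, ?_, ?_⟩
  · intro h hh x
    have hderiv : ∀ t : ℝ, HasDerivAt (fun t : ℝ => f (h, x + (t * h) • e))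
        (h * G ((h, x), t)) t := by
      intro t
      have hl : HasDerivAt (fun t : ℝ => (h, x + (t * h) • e)) ((0 : ℝ), h • e) t := by
        refine (hasDerivAt_const t h).prodMk ?_
        simpa using (((hasDerivAt_id t).mul_const h).smul_const e).const_add x
      convert! (hdiff _).hasFDerivAt.comp_hasDerivAt t hl using 1
      have : ((0 : ℝ), h • e) = h • ((0 : ℝ), e) := by simp
      rw [this, map_smul, smul_eq_mul]
    have hint := intervalIntegral.integral_eq_sub_of_hasDerivAt (a := 0) (b := 1)
      (fun t _ => hderiv t)
      ((continuous_const.mul (hG.continuous.comp (by fun_prop))).intervalIntegrable _ _)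
    rw [intervalIntegral.integral_const_mul] at hint
    simp only [one_mul, zero_mul, zero_smul, add_zero] at hint
    rw [eq_div_iff hh, mul_comm, hint]
  · intro x
    have hcomp := (hdiff (0, x)).hasFDerivAt.comp x (hasFDerivAt_prodMk_right (𝕜 := ℝ) (0 : ℝ) x)
    have := hcomp.fderiv
    simp only [Function.comp_def] at this
    simp [G, this]

/-- Backward version of `exists_contDiff_forward_quotient`. -/
theorem exists_contDiff_backward_quotient {n : ℕ} {f : ℝ × E → ℝ} (hf : ContDiff ℝ (n + 1) f)
    (e : E) :
    ∃ g : ℝ × E → ℝ, ContDiff ℝ n g ∧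
      (∀ h, h ≠ 0 → ∀ x, g (h, x) = (f (h, x) - f (h, x - h • e)) / h) ∧
      ∀ x, g (0, x) = fderiv ℝ (fun y => f (0, y)) x e := by
  obtain ⟨g, hg, hg1, hg0⟩ := exists_contDiff_forward_quotient hf (-e)
  refine ⟨fun p => -g p, hg.neg, fun h hh x => ?_, fun x => ?_⟩
  · simp only [hg1 h hh]
    rw [smul_neg, ← sub_eq_add_neg]
    ring
  · simp [hg0]

end ParametricIntegral

section Determinant

variable {ι : Type} [Fintype ι] [DecidableEq ι]

theorem ContDiff.matrix_det {E : Type} [NormedAddCommGroup E] [NormedSpace ℝ E] {n : WithTop ℕ∞}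
    {A : E → Matrix ι ι ℝ} (hA : ∀ i j, ContDiff ℝ n fun x => A x i j) :
    ContDiff ℝ n fun x => (A x).det := by
  simp only [Matrix.det_apply']
  exact ContDiff.sum fun σ _ => contDiff_const.mul (contDiff_prod fun i _ => hA _ _)

theorem fderiv_matrix_det_rows {E : Type} [NormedAddCommGroup E] [NormedSpace ℝ E]
    {A : E → Matrix ι ι ℝ} {A' : ι → E →L[ℝ] (ι → ℝ)} {x : E}
    (hA : ∀ i, HasFDerivAt (fun y => A y i) (A' i) x) (e : E) :
    fderiv ℝ (fun y => (A y).det) x e = ∑ k, ((A x).updateRow k (A' k e)).det := by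
  let f : ContinuousMultilinearMap ℝ (fun _ : ι => ι → ℝ) ℝ :=
    { (Matrix.detRowAlternating : (ι → ℝ) [⋀^ι]→ₗ[ℝ] ℝ).toMultilinearMap with
      cont := Continuous.matrix_det (A := fun B : Matrix ι ι ℝ => B) continuous_id }
  have h : HasFDerivAt (fun y => (A y).det) _ x := HasFDerivAt.multilinear_comp (f := f) hA
  rw [h.fderiv]
  simp only [sum_apply, ContinuousLinearMap.comp_apply]
  rfl

/-- The algebraic core of the divergence-free property of the cofactor matrix of a Hessian. -/
theorem sum_sum_det_updateRow_updateRow (A : Matrix ι ι ℝ) (g : ι → ℝ) (T : ι → ι → ι → ℝ)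
    (hT : ∀ i k, T i k = T k i) :
    ∑ i, ∑ k, ((A.updateRow i g).updateRow k (if k = i then A i else T i k)).det
      = Fintype.card ι * A.det := by
  let S : ι → ι → ℝ := fun i k =>
    if k = i then 0 else ((A.updateRow i g).updateRow k (T i k)).det
  have hS : ∀ i k, S i k = -S k i := by
    intro i k
    by_cases hik : k = i
    · simp [S, hik]
    · simp only [S, if_neg hik, if_neg (Ne.symm hik)]
      have hswap : (A.updateRow i g).updateRow k (T i k)
          = ((A.updateRow k g).updateRow i (T k i)).submatrix (Equiv.swap i k) id := by
        ext m l
        by_cases hmk : m = k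
        · subst hmk
          simp [hT i m]
        by_cases hmi : m = i
        · subst hmi
          simp [Matrix.updateRow_ne hmk, Matrix.updateRow_ne (Ne.symm hmk)]
        · simp [Equiv.swap_apply_of_ne_of_ne hmi hmk, Matrix.updateRow_ne, hmi, hmk]
      rw [hswap, Matrix.det_permute, Equiv.Perm.sign_swap (Ne.symm hik)]
      simp
  have hsum : ∑ i, ∑ k, S i k = 0 := by
    have h1 : ∑ i, ∑ k, S i k = ∑ i, ∑ k, -S i k := by
      rw [Finset.sum_comm]
      exact Finset.sum_congr rfl fun i _ => Finset.sum_congr rfl fun k _ => hS k i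
    simp only [Finset.sum_neg_distrib] at h1
    linarith
  have hsplit : ∀ i k, ((A.updateRow i g).updateRow k (if k = i then A i else T i k)).det
      = S i k + if k = i then A.det else 0 := by
    intro i k
    by_cases hik : k = i
    · subst hik
      simp [S]
    · simp [S, hik]
  simp only [hsplit, Finset.sum_add_distrib, hsum]
  simp

end Determinant

namespace MA

variable {d : ℕ}

theorem hess_apply_s6 (v : (Fin d → ℝ) → ℝ) (hv : ContDiff ℝ 2 v) (x : Fin d → ℝ) (i j : Fin d) :
    hess v x i j = fderiv ℝ (fun y => fderiv ℝ v y (bv d j)) x (bv d i) := by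
  have h : DifferentiableAt ℝ (fderiv ℝ v) x :=
    (hv.fderiv_right (m := 1) le_rfl).differentiable one_ne_zero x
  rw [fderiv_clm_apply h (differentiableAt_const _)]
  simp [hess, iteratedFDeriv_two_apply]

theorem hess_symm (v : (Fin d → ℝ) → ℝ) (hv : ContDiff ℝ 2 v) (x : Fin d → ℝ) (i j : Fin d) :
    hess v x i j = hess v x j i := by
  have := (hv.contDiffAt (x := x)).isSymmSndFDerivAt (by simp) (bv d i) (bv d j)
  simpa [hess, iteratedFDeriv_two_apply] using this

theorem contDiff_hess_apply (v : (Fin d → ℝ) → ℝ) (hv : ContDiff ℝ 3 v) (i j : Fin d) :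
    ContDiff ℝ 1 fun x => hess v x i j := by
  simp only [hess_apply_s6 v (hv.of_le (by norm_num))]
  exact ((((hv.fderiv_right (m := 2) (by norm_num)).clm_apply contDiff_const).fderiv_right
    (m := 1) (by norm_num)).clm_apply contDiff_const)

/-- Third derivatives commute. -/
theorem fderiv_hess_symm (v : (Fin d → ℝ) → ℝ) (hv : ContDiff ℝ 3 v) (x : Fin d → ℝ)
    (i k l : Fin d) :
    fderiv ℝ (fun y => hess v y k l) x (bv d i) = fderiv ℝ (fun y => hess v y i l) x (bv d k) := by
  have h2 : ContDiff ℝ 2 v := hv.of_le (by norm_num)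
  have hl : ContDiff ℝ 2 fun y => fderiv ℝ v y (bv d l) :=
    (hv.fderiv_right (m := 2) (by norm_num)).clm_apply contDiff_const
  simp only [hess_apply_s6 v h2]
  rw [← hess_apply_s6 _ hl, ← hess_apply_s6 _ hl, hess_symm _ hl]

/-- The continuous counterpart of the compatible operator: `div ((cof D²v) Dv) = d det D²v`. -/
theorem sum_fderiv_det_updateRow_hess (v : (Fin d → ℝ) → ℝ) (hv : ContDiff ℝ 3 v)
    (x : Fin d → ℝ) :
    ∑ i, fderiv ℝ (fun y => ((hess v y).updateRow i fun j => fderiv ℝ v y (bv d j)).det) x (bv d i)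
      = d * (hess v x).det := by
  have h2 : ContDiff ℝ 2 v := hv.of_le (by norm_num)
  let H' : Fin d → (Fin d → ℝ) →L[ℝ] (Fin d → ℝ) := fun k =>
    ContinuousLinearMap.pi fun l => fderiv ℝ (fun y => hess v y k l) x
  let g' : (Fin d → ℝ) →L[ℝ] (Fin d → ℝ) :=
    ContinuousLinearMap.pi fun l => fderiv ℝ (fun y => fderiv ℝ v y (bv d l)) x
  have hH : ∀ k, HasFDerivAt (fun y => hess v y k) (H' k) x := fun k =>
    hasFDerivAt_pi.2 fun l =>
      ((contDiff_hess_apply v hv k l).differentiable one_ne_zero x).hasFDerivAt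
  have hg : HasFDerivAt (fun y => fun j => fderiv ℝ v y (bv d j)) g' x :=
    hasFDerivAt_pi.2 fun l => ((((h2.fderiv_right (m := 1) le_rfl).clm_apply
      contDiff_const).differentiable one_ne_zero) x).hasFDerivAt
  have hrow : ∀ i k, HasFDerivAt
      (fun y => ((hess v y).updateRow i fun j => fderiv ℝ v y (bv d j)) k)
      (if k = i then g' else H' k) x := by
    intro i k
    by_cases hik : k = i
    · subst hik
      simpa using hg
    · simpa [hik, Matrix.updateRow_ne hik] using hH k
  have hterm : ∀ i k, (if k = i then g' else H' k) (bv d i)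
      = if k = i then hess v x i else H' k (bv d i) := by
    intro i k
    by_cases hik : k = i
    · simp only [if_pos hik]
      ext l
      simp [g', hess_apply_s6 v h2]
    · simp [hik]
  simp only [fderiv_matrix_det_rows (hrow _), hterm]
  rw [sum_sum_det_updateRow_updateRow (hess v x) _ (fun i k => H' k (bv d i)), Fintype.card_fin]
  intro i k
  ext l
  exact fderiv_hess_symm v hv x i k l

theorem cof_mulVec_apply (A : Matrix (Fin d) (Fin d) ℝ) (g : Fin d → ℝ) (i : Fin d) :
    (cof A).mulVec g i = (A.updateRow i g).det := by
  rw [cof, Matrix.adjugate_transpose, ← Matrix.cramer_eq_adjugate_mulVec,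
    Matrix.cramer_transpose_apply]

/-- The compatible operator extends to `h = 0` as a function that is jointly `C¹` in `(h, x)`. -/
theorem exists_contDiff_extension (hd : d ≠ 0) (v : (Fin d → ℝ) → ℝ) (hv : ContDiff ℝ 4 v) :
    ∃ Φ : ℝ × (Fin d → ℝ) → ℝ, ContDiff ℝ 1 Φ ∧
      (∀ h, h ≠ 0 → ∀ x, Φ (h, x) = MAh h v x) ∧ ∀ x, Φ (0, x) = (hess v x).det := by
  have h3 : ContDiff ℝ 3 v := hv.of_le (by norm_num)
  have h2 : ContDiff ℝ 2 v := hv.of_le (by norm_num)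
  have hf : ContDiff ℝ ((3 : ℕ) + 1) fun p : ℝ × (Fin d → ℝ) => v p.2 :=
    (hv.of_le (by norm_num)).comp contDiff_snd
  choose P hP hP1 hP0 using fun i => exists_contDiff_forward_quotient hf (bv d i)
  choose Q hQ hQ1 hQ0 using fun i j =>
    exists_contDiff_backward_quotient (n := 2) ((hP i).of_le (by norm_num)) (bv d j)
  let W : Fin d → ℝ × (Fin d → ℝ) → ℝ := fun i p =>
    ((symPart (Matrix.of fun k l => Q k l p)).updateRow i fun j => P j p).det
  have hW : ∀ i, ContDiff ℝ ((1 : ℕ) + 1) (W i) := by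
    intro i
    refine ContDiff.matrix_det fun k l => ?_
    by_cases hki : k = i
    · subst hki
      simpa using (hP l).of_le (by norm_num)
    · simp only [Matrix.updateRow_ne hki, symPart, Matrix.smul_apply, Matrix.add_apply,
        Matrix.transpose_apply, Matrix.of_apply, smul_eq_mul]
      exact (contDiff_const.mul ((hQ k l).add (hQ l k))).of_le (by norm_num)
  choose Z hZ hZ1 hZ0 using fun i => exists_contDiff_backward_quotient (hW i) (bv d i)
  refine ⟨fun p => 1 / (d : ℝ) * ∑ i, Z i p, ?_, fun h hh x => ?_, fun x => ?_⟩
  · exact contDiff_const.mul (ContDiff.sum fun i _ => (hZ i).of_le (by norm_num))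
  · have hPd : ∀ i y, P i (h, y) = dp h i v y := fun i y => hP1 i h hh y
    have hWd : ∀ i y, W i (h, y) = (cof (symPart (Hd h v y))).mulVec (Dh h v y) i := by
      intro i y
      rw [cof_mulVec_apply]
      simp only [W, hQ1 _ _ h hh, hPd]
      rfl
    simp only [hZ1 _ h hh, hWd]
    rfl
  · have hM : ∀ y, symPart (Matrix.of fun k l => Q k l (0, y)) = hess v y := by
      intro y
      ext k l
      simp only [symPart, Matrix.smul_apply, Matrix.add_apply, Matrix.transpose_apply,
        Matrix.of_apply, smul_eq_mul, hQ0, hP0, ← hess_apply_s6 v h2]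
      rw [hess_symm v h2 y l k]
      ring
    simp only [hZ0, W, hM, hP0]
    rw [sum_fderiv_det_updateRow_hess v h3]
    field_simp

end MA

/-- first order consistency of the compatible discretization
`(1/d) div_h[(cof sym H_d(r_h v)) D_h(r_h v)]` with `det D²v`. -/
theorem stmt6 {d : ℕ} (hd : 2 ≤ d) (Ω : Set (Fin d → ℝ))
    (hΩo : IsOpen Ω) (hΩc : Convex ℝ Ω) (hΩb : Bornology.IsBounded Ω)
    (v : (Fin d → ℝ) → ℝ) (hv : ContDiff ℝ 4 v) :
    ∃ C h0 : ℝ, 0 < C ∧ 0 < h0 ∧ h0 < 1 ∧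
      ∀ h : ℝ, 0 < h → h ≤ h0 → ∀ x ∈ MA.OmegaH0 Ω h,
        |MA.MAh h v x - (MA.hess v x).det| ≤ C * h := by
  obtain ⟨Φ, hΦ, hΦ1, hΦ0⟩ := MA.exists_contDiff_extension (by omega) v hv
  have hK : IsCompact (Set.Icc (0 : ℝ) 1 ×ˢ closure Ω) := isCompact_Icc.prod hΩb.isCompact_closure
  obtain ⟨B, hB⟩ := hK.exists_bound_of_continuousOn (hΦ.continuous_fderiv one_ne_zero).continuousOn
  refine ⟨max B 1, 1 / 2, by positivity, by norm_num, by norm_num, fun h hh hh' x hx => ?_⟩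
  have hxΩ : x ∈ closure Ω := hx.1.1
  have hmv := ((convex_Icc (0 : ℝ) 1).prod hΩc.closure).norm_image_sub_le_of_norm_fderiv_le
    (fun p _ => hΦ.differentiable one_ne_zero p) hB
    (x := (0, x)) (y := (h, x)) ⟨by simp, hxΩ⟩ ⟨⟨hh.le, by linarith⟩, hxΩ⟩
  rw [hΦ1 h hh.ne', hΦ0, Real.norm_eq_abs] at hmv
  have hnorm : ‖((h, x) : ℝ × (Fin d → ℝ)) - (0, x)‖ = h := by
    simp [Prod.norm_def, abs_of_pos hh, hh.le]
  rw [hnorm] at hmv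
  exact hmv.trans (by gcongr; exact le_max_left _ _)
end
end
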